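/- arXiv:1510.02510 — 6 statements merged into one kernel-verified Lean document; each statement's English description precedes it below -/
import Mathlib

section
/- Let Σ be a positive definite real matrix indexed by a finite set V, let K = Σ⁻¹, and suppose K implies the graph G = (V, E). Then for every pair of distinct vertices x, y ∈ V, the covariance σ_xy = Σ_xy decomposes over the paths of G as σ_xy = Σ_{π ∈ Π_xy} ω(π, Σ) = Σ_{π ∈ Π_xy} (−1)^{|P|+1} · (det K_{P̄P̄} / det K) · Π_{{u,v} ∈ E(π)} K_uv, where for each path π, P = V(π), P̄ = V \ P, and det K_{P̄P̄} is interpreted as 1 when P̄ = ∅. (Covariance decomposition over an undirected graph, Theorem 1.) -/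
open Matrix BigOperators

variable {V : Type*} [Fintype V] [DecidableEq V]

/-- Submatrix of `M` with rows indexed by `A` and columns indexed by `B`. -/
def subm (M : Matrix V V ℝ) (A B : Finset V) : Matrix A B ℝ :=
  M.submatrix (fun i => (i : V)) (fun j => (j : V))

/-- Partial covariance matrix `Σ_{AA·B} = Σ_AA − Σ_AB (Σ_BB)⁻¹ Σ_BA`. -/
noncomputable def pcov (M : Matrix V V ℝ) (A B : Finset V) : Matrix A A ℝ :=
  subm M A A - subm M A B * (subm M B B)⁻¹ * subm M B A

/-- A matrix `K` indexed by `W` implies a graph `G` on `W` if every nonzero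
off-diagonal entry of `K` corresponds to an edge of `G`. -/
def MatImplies {W : Type*} (K : Matrix W W ℝ) (G : SimpleGraph W) : Prop :=
  ∀ u v : W, u ≠ v → K u v ≠ 0 → G.Adj u v

/-- Path weight `ω(π, Γ) = (−1)^{|P|+1} det(Γ_PP) ∏_{{u,v} ∈ E(π)} (Γ⁻¹)_uv`. -/
noncomputable def pathWeight {G : SimpleGraph V} {x y : V} (M : Matrix V V ℝ) (p : G.Walk x y) : ℝ :=
  (-1 : ℝ) ^ (p.support.toFinset.card + 1)
    * (subm M p.support.toFinset p.support.toFinset).det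
    * (p.darts.map (fun d => M⁻¹ d.toProd.1 d.toProd.2)).prod

/-- Vector alienation coefficient `λ_{A:B}`. -/
noncomputable def alien (M : Matrix V V ℝ) (A B : Finset V) : ℝ :=
  (subm M (A ∪ B) (A ∪ B)).det / ((subm M A A).det * (subm M B B).det)

/-- Squared vector correlation `ρ²_{A:B} = 1 − λ_{A:B}`. -/
noncomputable def rho2 (M : Matrix V V ℝ) (A B : Finset V) : ℝ :=
  1 - alien M A B

/-- Partial vector alienation coefficient `λ_{A:B|C}`. -/
noncomputable def alienCond (M : Matrix V V ℝ) (A B C : Finset V) : ℝ :=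
  (pcov M (A ∪ B) C).det / ((pcov M A C).det * (pcov M B C).det)

/-- Squared partial vector correlation `ρ²_{A:B|C}`, with the convention that it
is `0` whenever `A = ∅` or `B = ∅`. -/
noncomputable def rho2Cond (M : Matrix V V ℝ) (A B C : Finset V) : ℝ :=
  if A = ∅ ∨ B = ∅ then 0 else 1 - alienCond M A B C

/-- The limited-order networked partial covariance
`ω_{xy·Q} = ω(⟨x,y⟩, Σ_{(Q∪{x,y})(Q∪{x,y})})
          = (−1) · det(Σ_{{x,y}{x,y}}) · ((Σ_{(Q∪{x,y})(Q∪{x,y})})⁻¹)_{xy}`. -/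
noncomputable def npcov (M : Matrix V V ℝ) (Q : Finset V) (x y : V) : ℝ :=
  (-1 : ℝ) * (subm M {x, y} {x, y}).det *
    (subm M (Q ∪ {x, y}) (Q ∪ {x, y}))⁻¹ ⟨x, by simp⟩ ⟨y, by simp⟩
/-- The matrix equal to `K` on `A × A` and to the identity elsewhere. -/
def padM (K : Matrix V V ℝ) (A : Finset V) : Matrix V V ℝ :=
  Matrix.of fun i j => if i ∈ A ∧ j ∈ A then K i j else if i = j then 1 else 0

lemma padM_apply (K : Matrix V V ℝ) (A : Finset V) (i j : V) :
    padM K A i j = if i ∈ A ∧ j ∈ A then K i j else if i = j then 1 else 0 := rfl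

lemma det_of_id_cols (N : Matrix V V ℝ) (A : Finset V)
    (h : ∀ i j, j ∉ A → N i j = if i = j then 1 else 0) :
    N.det = (subm N A A).det := by
  rw [Matrix.twoBlockTriangular_det' N (fun i => i ∈ A)]
  · have h1 : (Matrix.toSquareBlockProp N fun i => ¬ (i ∈ A)) = 1 := by
      ext i j
      simp only [Matrix.toSquareBlockProp_def, Matrix.of_apply, Matrix.one_apply]
      rw [h _ _ j.2]
      simp [Subtype.ext_iff]
    rw [h1, Matrix.det_one, mul_one]
    convert rfl using 2
    rfl
  · intro i hi j hj
    rw [h i j hj, if_neg]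
    rintro rfl
    exact hj hi

lemma det_padM (K : Matrix V V ℝ) (A : Finset V) :
    (padM K A).det = (subm K A A).det := by
  rw [det_of_id_cols (padM K A) A]
  · congr 1
    ext i j
    simp [subm, padM_apply]
  · intro i j hj
    simp [padM_apply, hj]

lemma det_padM_ne (K : Matrix V V ℝ) (hK : K.PosDef) (A : Finset V) :
    (padM K A).det ≠ 0 := by
  rw [det_padM]
  have : (subm K A A).PosDef := hK.submatrix Subtype.val_injective
  exact this.det_pos.ne'

lemma jacobi (S K : Matrix V V ℝ) (hKS : K * S = 1) (P : Finset V) :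
    (subm S P P).det = (subm K Pᶜ Pᶜ).det / K.det := by
  have hd : K.det * S.det = 1 := by rw [← Matrix.det_mul, hKS, Matrix.det_one]
  have hK0 : K.det ≠ 0 := left_ne_zero_of_mul_eq_one hd
  let E : Matrix V V ℝ := Matrix.of fun i j => if j ∈ P then S i j else if i = j then 1 else 0
  have hE : E.det = (subm S P P).det := by
    rw [det_of_id_cols E P]
    · congr 1
      ext i j
      simp [subm, E]
    · intro i j hj
      simp [E, hj]
  have hKE : ∀ i j, (K * E) i j = if j ∈ P then (if i = j then 1 else 0) else K i j := by
    intro i j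
    split_ifs with h1 h2
    · have : (K * E) i j = (K * S) i j := by simp [Matrix.mul_apply, E, h1]
      rw [this, hKS, h2, Matrix.one_apply_eq]
    · have : (K * E) i j = (K * S) i j := by simp [Matrix.mul_apply, E, h1]
      rw [this, hKS, Matrix.one_apply_ne h2]
    · simp [Matrix.mul_apply, E, h1]
  have h2 : (K * E).det = (subm K Pᶜ Pᶜ).det := by
    rw [det_of_id_cols (K * E) Pᶜ]
    · congr 1
      ext i j
      have := j.2
      rw [Finset.mem_compl] at this
      simp [subm, hKE, this]
    · intro i j hj
      rw [Finset.mem_compl, not_not] at hj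
      rw [hKE, if_pos hj]
  rw [Matrix.det_mul, hE] at h2
  rw [← h2]
  field_simp

lemma adj_padM_self (K : Matrix V V ℝ) (A : Finset V) (x : V) :
    (padM K A).adjugate x x = (padM K (A.erase x)).det := by
  rw [Matrix.adjugate_apply]
  set C := (padM K A).updateRow x (Pi.single x 1) with hC
  have h1 : padM K (A.erase x) = C.updateCol x (Pi.single x 1) := by
    ext i j
    simp only [hC, padM_apply, Matrix.updateCol_apply, Matrix.updateRow_apply, Pi.single_apply,
      Finset.mem_erase]
    grind
  have h2 : (C.updateCol x (Pi.single x 1)).det = C.adjugate x x := by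
    rw [Matrix.adjugate_def, Matrix.of_apply, Matrix.cramer_apply, Matrix.updateCol_transpose,
      Matrix.det_transpose, ← Matrix.cramer_apply, ← Matrix.adjugate_apply]
    rw [← Matrix.transpose_apply (Matrix.adjugate C), Matrix.adjugate_transpose,
      Matrix.adjugate_def, Matrix.of_apply, Matrix.transpose_transpose]
  rw [h1, h2, Matrix.adjugate_apply]
  congr 1
  ext i j
  simp only [hC, Matrix.updateRow_apply]
  grind

lemma adj_padM_rec (K : Matrix V V ℝ) (hK : K.PosDef) (A : Finset V) (x y : V)
    (hx : x ∈ A) (hxy : x ≠ y) :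
    (padM K A).adjugate x y =
      -∑ z, (if z ∈ A.erase x then K x z else 0) * (padM K (A.erase x)).adjugate z y := by
  have hD := det_padM_ne K hK A
  have hDB := det_padM_ne K hK (A.erase x)
  set MA := padM K A with hMA
  set MB := padM K (A.erase x) with hMB
  let c : V → ℝ := fun z => if z ∈ A.erase x then K x z else 0
  let t : V → ℝ := c ᵥ* MB.adjugate
  have ht : t ᵥ* MB = MB.det • c := by
    simp only [t, Matrix.vecMul_vecMul, Matrix.adjugate_mul, Matrix.vecMul_smul, Matrix.vecMul_one]
  have htx : t x = 0 := by
    have h := congrFun ht x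
    simp only [Matrix.vecMul, dotProduct, hMB, padM_apply, Finset.mem_erase] at h
    simpa [c] using h
  have htA : ∀ j, j ≠ x → (t ᵥ* MA) j = MB.det * c j := by
    intro j hj
    have h := congrFun ht j
    rw [Pi.smul_apply, smul_eq_mul] at h
    rw [← h]
    simp only [Matrix.vecMul, dotProduct]
    refine Finset.sum_congr rfl fun i _ => ?_
    by_cases hi : i = x
    · rw [hi, htx, zero_mul, zero_mul]
    · simp [hMA, hMB, padM_apply, hi, hj]
  let u : V → ℝ := Pi.single x MB.det - t
  have hu : ∃ s : ℝ, u ᵥ* MA = Pi.single x s := by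
    refine ⟨(u ᵥ* MA) x, ?_⟩
    ext j
    by_cases hj : j = x
    · subst hj; simp
    · rw [Pi.single_eq_of_ne hj]
      simp only [u, Matrix.sub_vecMul, Pi.sub_apply, htA j hj, Matrix.single_vecMul]
      simp [c, hMA, padM_apply, hx, hj, Ne.symm hj]
  obtain ⟨s, hs⟩ := hu
  have h3 : ∀ j, MA.det * u j = s * MA.adjugate x j := by
    intro j
    have h : (u ᵥ* MA) ᵥ* MA.adjugate = MA.det • u := by
      simp only [Matrix.vecMul_vecMul, Matrix.mul_adjugate, Matrix.vecMul_smul, Matrix.vecMul_one]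
    have h := congrFun h j
    rw [hs, Matrix.single_vecMul] at h
    simpa using h.symm
  have hs' : s = MA.det := by
    have h := h3 x
    rw [adj_padM_self] at h
    simp only [u, Pi.sub_apply, Pi.single_eq_same, htx, sub_zero] at h
    exact (mul_right_cancel₀ hDB h).symm
  have h4 := h3 y
  rw [hs'] at h4
  have h5 := mul_left_cancel₀ hD h4
  rw [← h5]
  simp only [u, Pi.sub_apply, Pi.single_eq_of_ne hxy.symm, zero_sub]
  rfl

open Classical in
/-- Splitting off the first edge of a path. -/
lemma sum_path_cons (G : SimpleGraph V) [DecidableRel G.Adj] (x y : V) (hxy : x ≠ y)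
    (f : G.Walk x y → ℝ) :
    ∑ p : G.Path x y, f p = ∑ z, ∑ q : G.Path z y,
      if h : G.Adj x z ∧ x ∉ (q : G.Walk z y).support then f (SimpleGraph.Walk.cons h.1 q) else 0 := by
  let T := {s : (Σ z, G.Path z y) // G.Adj x s.1 ∧ x ∉ (s.2 : G.Walk s.1 y).support}
  let φ : T → G.Path x y := fun s =>
    ⟨SimpleGraph.Walk.cons s.2.1 s.1.2, by
      rw [SimpleGraph.Walk.cons_isPath_iff]; exact ⟨s.1.2.2, s.2.2⟩⟩
  have hφ : Function.Bijective φ := by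
    constructor
    · rintro ⟨⟨z, q, hq⟩, h⟩ ⟨⟨z', q', hq'⟩, h'⟩ he
      simp only [φ, Subtype.mk.injEq, SimpleGraph.Walk.cons.injEq] at he
      obtain ⟨rfl, he⟩ := he
      obtain rfl := eq_of_heq he
      rfl
    · rintro ⟨p, hp⟩
      cases p with
      | nil => exact absurd rfl hxy
      | cons h q =>
        have hp' := (SimpleGraph.Walk.cons_isPath_iff h q).1 hp
        exact ⟨⟨⟨_, q, hp'.1⟩, h, hp'.2⟩, rfl⟩
  rw [← (Equiv.ofBijective φ hφ).sum_comp]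
  rw [← Fintype.sum_sigma (fun s : (Σ z, G.Path z y) =>
      if h : G.Adj x s.1 ∧ x ∉ (s.2 : G.Walk s.1 y).support then
      f (SimpleGraph.Walk.cons h.1 s.2) else 0)]
  rw [Finset.sum_dite]
  simp only [Finset.sum_const_zero, add_zero]
  refine Finset.sum_bij (fun s _ => ⟨s.1, by simpa using s.2⟩) ?_ ?_ ?_ ?_
  · simp
  · rintro ⟨a, ha⟩ _ ⟨b, hb⟩ _ h
    have h' : a = b := by simpa using h
    subst h'
    rfl
  · rintro ⟨b, hb⟩ _
    exact ⟨⟨b, by simpa using hb⟩, by simp, rfl⟩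
  · intro a _
    rfl

open Classical in
lemma adj_padM_paths (K : Matrix V V ℝ) (hK : K.PosDef) (G : SimpleGraph V) [DecidableRel G.Adj]
    (hGK : MatImplies K G) (y : V) (n : ℕ) : ∀ (A : Finset V) (x : V), A.card = n → x ∈ A → y ∈ A →
    (padM K A).adjugate x y = ∑ p : G.Path x y,
      if (p : G.Walk x y).support.toFinset ⊆ A then
        (-1 : ℝ) ^ (p : G.Walk x y).length * (padM K (A \ (p : G.Walk x y).support.toFinset)).det
          * ((p : G.Walk x y).darts.map (fun d => K d.toProd.1 d.toProd.2)).prod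
      else 0 := by
  induction n with
  | zero =>
    intro A x hA hx
    rw [Finset.card_eq_zero] at hA
    simp [hA] at hx
  | succ n ih =>
    intro A x hA hx hy
    by_cases hxy : x = y
    · subst hxy
      rw [adj_padM_self, Finset.sum_eq_single SimpleGraph.Path.nil]
      · simp [hx, Finset.sdiff_singleton_eq_erase]
      · intro p _ hp
        exact absurd p.loop_eq hp
      · simp
    · have hcard : (A.erase x).card = n := by rw [Finset.card_erase_of_mem hx, hA]; rfl
      have hyB : y ∈ A.erase x := Finset.mem_erase.2 ⟨Ne.symm hxy, hy⟩
      rw [adj_padM_rec K hK A x y hx hxy, sum_path_cons G x y hxy (fun p =>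
        if p.support.toFinset ⊆ A then
        (-1 : ℝ) ^ p.length * (padM K (A \ p.support.toFinset)).det
          * (p.darts.map (fun d => K d.toProd.1 d.toProd.2)).prod else 0), ← Finset.sum_neg_distrib]
      refine Finset.sum_congr rfl fun z _ => ?_
      by_cases hz : z ∈ A.erase x
      · rw [if_pos hz, ih _ z hcard hz hyB, Finset.mul_sum, ← Finset.sum_neg_distrib]
        refine Finset.sum_congr rfl fun q _ => ?_
        have hsub : (q : G.Walk z y).support.toFinset ⊆ A.erase x ↔
            x ∉ (q : G.Walk z y).support ∧ (q : G.Walk z y).support.toFinset ⊆ A := by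
          rw [Finset.subset_erase, List.mem_toFinset, and_comm]
        by_cases hadj : G.Adj x z
        · by_cases hxs : x ∈ (q : G.Walk z y).support
          · simp [hsub, hxs]
          · by_cases hqA : (q : G.Walk z y).support.toFinset ⊆ A
            · have e1 : A \ (insert x (q : G.Walk z y).support.toFinset)
                  = A.erase x \ (q : G.Walk z y).support.toFinset := by
                ext i; simp; tauto
              rw [if_pos (hsub.2 ⟨hxs, hqA⟩), dif_pos ⟨hadj, hxs⟩]
              simp only [SimpleGraph.Walk.support_cons, List.toFinset_cons,
                SimpleGraph.Walk.length_cons, SimpleGraph.Walk.darts_cons, List.map_cons,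
                List.prod_cons, e1]
              rw [if_pos (Finset.insert_subset hx hqA), pow_succ]
              ring
            · rw [if_neg (fun h => hqA (hsub.1 h).2), dif_pos ⟨hadj, hxs⟩, if_neg]
              · simp
              · intro h
                rw [SimpleGraph.Walk.support_cons, List.toFinset_cons] at h
                exact hqA ((Finset.subset_insert _ _).trans h)
        · have hK0 : K x z = 0 := by
            by_contra h0
            exact hadj (hGK x z (Finset.ne_of_mem_erase hz).symm h0)
          simp [hadj, hK0]
      · rw [if_neg hz, zero_mul, neg_zero]
        symm
        refine Finset.sum_eq_zero fun q _ => ?_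
        split_ifs with h h2
        · exfalso
          apply hz
          refine Finset.mem_erase.2 ⟨h.1.ne', h2 ?_⟩
          simp
        · rfl
        · rfl


/-- covariance decomposition over an undirected graph (Theorem 1). -/
theorem covariance_decomposition_over_graph
    (S K : Matrix V V ℝ) (hS : S.PosDef) (hK : K = S⁻¹)
    (G : SimpleGraph V) [DecidableRel G.Adj] (hGK : MatImplies K G)
    (x y : V) (hxy : x ≠ y) :
    (S x y = ∑ p : G.Path x y, pathWeight S (p : G.Walk x y)) ∧
    (S x y = ∑ p : G.Path x y,
      (-1 : ℝ) ^ ((p : G.Walk x y).support.toFinset.card + 1)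
        * ((subm K ((p : G.Walk x y).support.toFinset)ᶜ
              ((p : G.Walk x y).support.toFinset)ᶜ).det / K.det)
        * ((p : G.Walk x y).darts.map (fun d => K d.toProd.1 d.toProd.2)).prod) := by
  subst hK
  have hKpd : (S⁻¹).PosDef := hS.inv
  have hSdet : IsUnit S.det := hS.det_pos.ne'.isUnit
  have hKS : S⁻¹ * S = 1 := Matrix.nonsing_inv_mul S hSdet
  have key : S x y = ∑ p : G.Path x y,
      (-1 : ℝ) ^ ((p : G.Walk x y).support.toFinset.card + 1)
        * ((subm S⁻¹ ((p : G.Walk x y).support.toFinset)ᶜ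
              ((p : G.Walk x y).support.toFinset)ᶜ).det / S⁻¹.det)
        * ((p : G.Walk x y).darts.map (fun d => S⁻¹ d.toProd.1 d.toProd.2)).prod := by
    have h := adj_padM_paths S⁻¹ hKpd G hGK y _ Finset.univ x rfl (Finset.mem_univ _)
      (Finset.mem_univ _)
    have hpad : padM S⁻¹ Finset.univ = S⁻¹ := by
      ext i j
      simp [padM_apply]
    rw [hpad] at h
    have hadj : S⁻¹.det * S x y = S⁻¹.adjugate x y := by
      have h1 : S⁻¹.adjugate * (S⁻¹ * S) = S⁻¹.det • S := by
        rw [← Matrix.mul_assoc, Matrix.adjugate_mul, Matrix.smul_mul, Matrix.one_mul]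
      rw [hKS, Matrix.mul_one] at h1
      rw [h1, Matrix.smul_apply, smul_eq_mul]
    have hd : S⁻¹.det ≠ 0 := hKpd.det_pos.ne'
    apply mul_left_cancel₀ hd
    rw [hadj, h, Finset.mul_sum]
    refine Finset.sum_congr rfl fun p _ => ?_
    have hcard : (p : G.Walk x y).support.toFinset.card = (p : G.Walk x y).length + 1 := by
      rw [List.toFinset_card_of_nodup p.2.support_nodup, SimpleGraph.Walk.length_support]
    rw [if_pos (Finset.subset_univ _), det_padM, ← Finset.compl_eq_univ_sdiff, hcard, pow_succ,
      pow_succ]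
    field_simp
  refine ⟨?_, key⟩
  rw [key]
  refine Finset.sum_congr rfl fun p _ => ?_
  rw [pathWeight, jacobi S S⁻¹ hKS]
end

section
/- Let Σ be a positive definite real matrix indexed by a finite set V with K = Σ⁻¹, and suppose K implies the graph G = (V, E). Then for every edge {x, y} ∈ E, the weight of the single-edge path ⟨x, y⟩ satisfies ω(⟨x, y⟩, Σ) = σ_{xy·V\{x,y}} / (1 − ρ²_{{x,y}:V\{x,y}}), i.e., the path weight equals the partial covariance of x and y given the remaining variables divided by one minus the squared vector correlation between the pair {x, y} and the remaining variables. (Theorem 2.) -/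
open Matrix BigOperators

variable {V : Type*} [Fintype V] [DecidableEq V]

theorem subm_mul_compl (M N : Matrix V V ℝ) (A C D : Finset V) :
    subm (M * N) C D = subm M C A * subm N A D + subm M C Aᶜ * subm N Aᶜ D := by
  ext i j
  simp only [subm, Matrix.submatrix_apply, Matrix.mul_apply, Matrix.add_apply]
  rw [Finset.sum_coe_sort A (fun k => M i k * N k j),
    Finset.sum_coe_sort Aᶜ (fun k => M i k * N k j), Finset.sum_add_sum_compl]

theorem subm_posDef (S : Matrix V V ℝ) (hS : S.PosDef) (A : Finset V) :
    (subm S A A).PosDef :=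
  hS.submatrix Subtype.val_injective

theorem pcov_mul_inv (S : Matrix V V ℝ) (hS : S.PosDef) (A : Finset V) :
    pcov S A Aᶜ * subm S⁻¹ A A = 1 := by
  have hu : S * S⁻¹ = 1 := Matrix.mul_nonsing_inv _ hS.det_pos.ne'.isUnit
  have h1 := subm_mul_compl S S⁻¹ A A A
  have h2 := subm_mul_compl S S⁻¹ A Aᶜ A
  rw [hu] at h1 h2
  have e1 : subm (1 : Matrix V V ℝ) A A = 1 :=
    Matrix.submatrix_one _ Subtype.val_injective
  have e2 : subm (1 : Matrix V V ℝ) Aᶜ A = 0 := by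
    ext i j
    have : (i : V) ≠ j := fun h => (Finset.mem_compl.1 i.2) (h ▸ j.2)
    simp [subm, Matrix.one_apply, this]
  rw [e1] at h1
  rw [e2] at h2
  have hB : (subm S Aᶜ Aᶜ)⁻¹ * subm S Aᶜ Aᶜ = 1 :=
    Matrix.nonsing_inv_mul _ (subm_posDef S hS Aᶜ).det_pos.ne'.isUnit
  have h3 : subm S Aᶜ A * subm S⁻¹ A A = - (subm S Aᶜ Aᶜ * subm S⁻¹ Aᶜ A) :=
    eq_neg_of_add_eq_zero_left h2.symm
  rw [pcov, Matrix.sub_mul, Matrix.mul_assoc, Matrix.mul_assoc, h3, Matrix.mul_neg,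
    ← Matrix.mul_assoc _ (subm S Aᶜ Aᶜ), hB, Matrix.one_mul, Matrix.mul_neg, sub_neg_eq_add]
  exact h1.symm

theorem det_union_eq (S : Matrix V V ℝ) (hS : S.PosDef) (A B : Finset V)
    (hd : Disjoint A B) :
    (subm S (A ∪ B) (A ∪ B)).det = (subm S B B).det * (pcov S A B).det := by
  have hB : IsUnit (subm S B B).det := (subm_posDef S hS B).det_pos.ne'.isUnit
  letI := Matrix.invertibleOfIsUnitDet _ hB
  rw [← Matrix.det_submatrix_equiv_self (Equiv.Finset.union A B hd) (subm S (A ∪ B) (A ∪ B))]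
  have : (subm S (A ∪ B) (A ∪ B)).submatrix (Equiv.Finset.union A B hd)
      (Equiv.Finset.union A B hd) =
      Matrix.fromBlocks (subm S A A) (subm S A B) (subm S B A) (subm S B B) := by
    ext (i | i) (j | j) <;> rfl
  rw [this, Matrix.det_fromBlocks₂₂, pcov, Matrix.invOf_eq_nonsing_inv]

theorem inv_pair {x y : V} (hxy : x ≠ y)
    (P : Matrix ({x, y} : Finset V) ({x, y} : Finset V) ℝ) :
    P⁻¹ ⟨x, by simp⟩ ⟨y, by simp⟩ = - P ⟨x, by simp⟩ ⟨y, by simp⟩ / P.det := by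
  let f : Fin 2 → ({x, y} : Finset V) := ![⟨x, by simp⟩, ⟨y, by simp⟩]
  have hf : Function.Bijective f := by
    constructor
    · intro i j hij
      fin_cases i <;> fin_cases j <;> simp_all [f]
    · rintro ⟨z, hz⟩
      rcases Finset.mem_insert.1 hz with h | h
      · exact ⟨0, Subtype.ext h.symm⟩
      · exact ⟨1, Subtype.ext (Finset.mem_singleton.1 h).symm⟩
  let e := Equiv.ofBijective f hf
  have h1 : P⁻¹ ⟨x, by simp⟩ ⟨y, by simp⟩ = (P.submatrix e e)⁻¹ 0 1 := by
    rw [Matrix.inv_submatrix_equiv]; rfl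
  rw [h1, Matrix.inv_def, Matrix.adjugate_fin_two, Matrix.det_submatrix_equiv_self]
  have h2 : (P.submatrix e e) 0 1 = P ⟨x, by simp⟩ ⟨y, by simp⟩ := rfl
  rw [h2]
  simp [div_eq_inv_mul]

/-- the single-edge path weight equals the partial covariance divided
by one minus the squared vector correlation (Theorem 2). -/
theorem single_edge_path_weight_eq
    (S K : Matrix V V ℝ) (hS : S.PosDef) (hK : K = S⁻¹)
    (G : SimpleGraph V) (hGK : MatImplies K G)
    (x y : V) (h : G.Adj x y) :
    pathWeight S (SimpleGraph.Walk.cons h SimpleGraph.Walk.nil)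
      = pcov S {x, y} ({x, y} : Finset V)ᶜ ⟨x, by simp⟩ ⟨y, by simp⟩
          / (1 - rho2 S {x, y} ({x, y} : Finset V)ᶜ) := by
  have hxy : x ≠ y := h.ne
  have hinv := Matrix.inv_eq_right_inv (pcov_mul_inv S hS {x, y})
  have hdet : (pcov S {x, y} ({x, y} : Finset V)ᶜ).det ≠ 0 := by
    intro h0
    have := congrArg Matrix.det (pcov_mul_inv S hS {x, y})
    rw [Matrix.det_mul, h0] at this
    simp at this
  have hp := inv_pair hxy (pcov S {x, y} ({x, y} : Finset V)ᶜ)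
  rw [hinv] at hp
  change S⁻¹ x y = _ at hp
  have hA := (subm_posDef S hS {x, y}).det_pos.ne'
  have hB := (subm_posDef S hS ({x, y} : Finset V)ᶜ).det_pos.ne'
  have hw : pathWeight S (SimpleGraph.Walk.cons h SimpleGraph.Walk.nil)
      = - ((subm S {x, y} {x, y}).det * S⁻¹ x y) := by
    have hs : (SimpleGraph.Walk.cons h SimpleGraph.Walk.nil).support.toFinset = {x, y} := by
      simp
    unfold pathWeight
    rw [hs, Finset.card_pair hxy]
    simp
    try norm_num
  rw [hw, hp, rho2, alien, det_union_eq S hS _ _ disjoint_compl_right]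
  generalize (pcov S {x, y} ({x, y} : Finset V)ᶜ).det = d at hdet ⊢
  generalize (subm S {x, y} {x, y}).det = a at hA ⊢
  generalize (subm S ({x, y} : Finset V)ᶜ ({x, y} : Finset V)ᶜ).det = b at hB ⊢
  generalize pcov S {x, y} ({x, y} : Finset V)ᶜ _ _ = p
  have hk : 1 - (1 - b * d / (a * b)) = d / a := by
    rw [sub_sub_cancel]
    field_simp
  rw [hk]
  field_simp
end

section
/- Let Σ be a positive definite real matrix indexed by a finite set V with K = Σ⁻¹, and suppose K implies the graph G = (V, E). Then for every edge {x, y} ∈ E, the normalized single-edge path weight satisfies ω(⟨x, y⟩, Σ) / sqrt(σ_{xx·V\{x,y}} · σ_{yy·V\{x,y}}) = ρ_{xy·V\{x,y}} / (1 − ρ²_{{x,y}:V\{x,y}}), where ρ_{xy·V\{x,y}} = σ_{xy·V\{x,y}} / sqrt(σ_{xx·V\{x,y}} · σ_{yy·V\{x,y}}) is the partial correlation. (Networked partial correlation identity, equation (7).) -/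
open Matrix BigOperators

variable {V : Type*} [Fintype V] [DecidableEq V]

theorem aux_schur (S : Matrix V V ℝ) (hS : S.PosDef) (A : Finset V) :
    S.det = (subm S Aᶜ Aᶜ).det * (pcov S A Aᶜ).det ∧ (subm S Aᶜ Aᶜ).det ≠ 0 ∧
    subm S⁻¹ A A = (pcov S A Aᶜ)⁻¹ := by
  classical
  let g : A ⊕ (Aᶜ : Finset V) → V := Sum.elim (fun i => (i : V)) (fun i => (i : V))
  have hg : Function.Bijective g := by
    constructor
    · rintro (⟨a, ha⟩ | ⟨a, ha⟩) (⟨b, hb⟩ | ⟨b, hb⟩) hab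
      · simpa [g] using hab
      · simp only [g, Sum.elim_inl, Sum.elim_inr] at hab
        subst hab
        exact absurd ha (Finset.mem_compl.1 hb)
      · simp only [g, Sum.elim_inl, Sum.elim_inr] at hab
        subst hab
        exact absurd hb (Finset.mem_compl.1 ha)
      · simpa [g] using hab
    · intro v
      by_cases hv : v ∈ A
      · exact ⟨Sum.inl ⟨v, hv⟩, rfl⟩
      · exact ⟨Sum.inr ⟨v, Finset.mem_compl.2 hv⟩, rfl⟩
  let e := Equiv.ofBijective g hg
  have hblock : S.submatrix e e =
      fromBlocks (subm S A A) (subm S A Aᶜ) (subm S Aᶜ A) (subm S Aᶜ Aᶜ) := by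
    ext (i | i) (j | j) <;> rfl
  have hD : (subm S Aᶜ Aᶜ).PosDef := hS.submatrix Subtype.val_injective
  have hDdet : (subm S Aᶜ Aᶜ).det ≠ 0 := hD.det_pos.ne'
  have hSdet : S.det ≠ 0 := hS.det_pos.ne'
  have : Invertible (subm S Aᶜ Aᶜ) := invertibleOfIsUnitDet _ (isUnit_iff_ne_zero.2 hDdet)
  have hdet : S.det = (subm S Aᶜ Aᶜ).det * (pcov S A Aᶜ).det := by
    rw [← det_submatrix_equiv_self e S, hblock, det_fromBlocks₂₂, invOf_eq_nonsing_inv]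
    rfl
  refine ⟨hdet, hDdet, ?_⟩
  have hCdet : (pcov S A Aᶜ).det ≠ 0 := by
    intro h0
    exact hSdet (by rw [hdet, h0, mul_zero])
  have hC' : pcov S A Aᶜ = subm S A A - subm S A Aᶜ * ⅟(subm S Aᶜ Aᶜ) * subm S Aᶜ A := by
    rw [invOf_eq_nonsing_inv]; rfl
  have : Invertible (subm S A A - subm S A Aᶜ * ⅟(subm S Aᶜ Aᶜ) * subm S Aᶜ A) :=
    invertibleOfIsUnitDet _ (isUnit_iff_ne_zero.2 (hC' ▸ hCdet))
  have : Invertible (fromBlocks (subm S A A) (subm S A Aᶜ) (subm S Aᶜ A) (subm S Aᶜ Aᶜ)) :=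
    invertibleOfIsUnitDet _ (isUnit_iff_ne_zero.2
      (by rw [← hblock, det_submatrix_equiv_self]; exact hSdet))
  have hinv := invOf_fromBlocks₂₂_eq (subm S A A) (subm S A Aᶜ) (subm S Aᶜ A) (subm S Aᶜ Aᶜ)
  have h2 := congrArg toBlocks₁₁ hinv
  rw [toBlocks_fromBlocks₁₁, invOf_eq_nonsing_inv, invOf_eq_nonsing_inv, ← hC', ← hblock,
    inv_submatrix_equiv] at h2
  rw [← h2]
  rfl

theorem aux_inv {x y : V} (hxy : x ≠ y)
    (C : Matrix ({x, y} : Finset V) ({x, y} : Finset V) ℝ) :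
    C⁻¹ ⟨x, by simp⟩ ⟨y, by simp⟩ = - (C ⟨x, by simp⟩ ⟨y, by simp⟩) / C.det := by
  classical
  let g : Fin 2 → ({x, y} : Finset V) := ![⟨x, by simp⟩, ⟨y, by simp⟩]
  have hg : Function.Bijective g := by
    constructor
    · intro a b hab
      fin_cases a <;> fin_cases b <;> simp_all [g]
    · rintro ⟨v, hv⟩
      rcases Finset.mem_insert.1 hv with rfl | hv'
      · exact ⟨0, rfl⟩
      · have := Finset.mem_singleton.1 hv'
        subst this
        exact ⟨1, rfl⟩
  let e := Equiv.ofBijective g hg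
  have h1 := congrFun (congrFun (inv_submatrix_equiv C e e) 0) 1
  have h2 : C⁻¹ ⟨x, by simp⟩ ⟨y, by simp⟩ = (C⁻¹).submatrix e e 0 1 := rfl
  have h3 : C ⟨x, by simp⟩ ⟨y, by simp⟩ = C.submatrix e e 0 1 := rfl
  rw [h2, h3, ← h1, ← det_submatrix_equiv_self e C, inv_def, adjugate_fin_two]
  simp [div_eq_inv_mul]

/-- networked partial correlation identity, equation (7). -/
theorem networked_partial_correlation_identity
    (S K : Matrix V V ℝ) (hS : S.PosDef) (hK : K = S⁻¹)
    (G : SimpleGraph V) (hGK : MatImplies K G)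
    (x y : V) (h : G.Adj x y) :
    pathWeight S (SimpleGraph.Walk.cons h SimpleGraph.Walk.nil)
        / Real.sqrt ((pcov S {x, y} ({x, y} : Finset V)ᶜ ⟨x, by simp⟩ ⟨x, by simp⟩)
            * (pcov S {x, y} ({x, y} : Finset V)ᶜ ⟨y, by simp⟩ ⟨y, by simp⟩))
      = ((pcov S {x, y} ({x, y} : Finset V)ᶜ ⟨x, by simp⟩ ⟨y, by simp⟩)
            / Real.sqrt ((pcov S {x, y} ({x, y} : Finset V)ᶜ ⟨x, by simp⟩ ⟨x, by simp⟩)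
                * (pcov S {x, y} ({x, y} : Finset V)ᶜ ⟨y, by simp⟩ ⟨y, by simp⟩)))
          / (1 - rho2 S {x, y} ({x, y} : Finset V)ᶜ) := by
  have hxy : x ≠ y := h.ne
  obtain ⟨hdet, hD, hinv⟩ := aux_schur S hS {x, y}
  have hKxy : S⁻¹ x y = - (pcov S {x, y} ({x, y} : Finset V)ᶜ ⟨x, by simp⟩ ⟨y, by simp⟩) /
      (pcov S {x, y} ({x, y} : Finset V)ᶜ).det := by
    rw [← aux_inv hxy, ← hinv]; rfl
  have hsupp : (SimpleGraph.Walk.cons h SimpleGraph.Walk.nil).support.toFinset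
      = ({x, y} : Finset V) := by simp
  have hw : pathWeight S (SimpleGraph.Walk.cons h SimpleGraph.Walk.nil)
      = - (subm S {x, y} {x, y}).det * S⁻¹ x y := by
    unfold pathWeight
    rw [hsupp, Finset.card_pair hxy]
    norm_num
  have huniv : (subm S ({x, y} ∪ ({x, y} : Finset V)ᶜ) ({x, y} ∪ ({x, y} : Finset V)ᶜ)).det
      = S.det := by
    rw [Finset.union_compl]
    exact det_submatrix_equiv_self (Equiv.subtypeUnivEquiv Finset.mem_univ) S
  have hal : 1 - rho2 S {x, y} ({x, y} : Finset V)ᶜ =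
      (pcov S {x, y} ({x, y} : Finset V)ᶜ).det / (subm S {x, y} {x, y}).det := by
    unfold rho2 alien
    rw [huniv, hdet, sub_sub_cancel, mul_comm (subm S {x, y} {x, y}).det,
      mul_div_mul_left _ _ hD]
  rw [hw, hal, hKxy, div_right_comm, div_div_eq_mul_div _ (pcov S {x, y} ({x, y} : Finset V)ᶜ).det]
  congr 1
  ring
end

section
/- Let Σ be a positive definite real matrix indexed by a finite set V with K = Σ⁻¹, and suppose K implies the graph G = (V, E). Let x, y ∈ V be distinct, Q ⊆ V \ {x, y}, and A = V \ Q. Then the partial covariance σ_{xy·Q} decomposes over the paths of the induced subgraph G_A as σ_{xy·Q} = Σ_{π ∈ Π_xy, V(π) ⊆ A} ω(π, Σ_{AA·Q}), where for each such path π with P = V(π), ω(π, Σ_{AA·Q}) = (−1)^{|P|+1} · det(Σ_{PP·Q}) · Π_{{u,v} ∈ E(π)} K_uv. (Intermediate identity, equation in the proof of Theorem 3.) -/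
open Matrix BigOperators

variable {V : Type*} [Fintype V] [DecidableEq V]

/-- The conditional covariance matrix given `Q`, as a full `V × V` matrix. -/
noncomputable def fullCov (S : Matrix V V ℝ) (Q : Finset V) : Matrix V V ℝ :=
  S - S.submatrix id (fun j : Q => (j : V)) * (subm S Q Q)⁻¹ *
    S.submatrix (fun j : Q => (j : V)) id

theorem pcov_eq_fullCov (S : Matrix V V ℝ) (A Q : Finset V) :
    pcov S A Q = (fullCov S Q).submatrix (fun i : A => (i : V)) (fun i : A => (i : V)) := by
  ext i j
  simp [pcov, fullCov, subm, Matrix.mul_apply]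

/-- Principal minor. -/
noncomputable def pdet (M : Matrix V V ℝ) (P : Finset V) : ℝ := (subm M P P).det

theorem pcov_det (S : Matrix V V ℝ) (A Q : Finset V) :
    (pcov S A Q).det = pdet (fullCov S Q) A := by
  rw [pcov_eq_fullCov]; rfl

theorem fullCov_row (S : Matrix V V ℝ) (hS : S.PosDef) (Q : Finset V) (v y : V) (hv : v ∈ Q) :
    fullCov S Q v y = 0 := by
  have hu : IsUnit (subm S Q Q).det := by
    have : (subm S Q Q).PosDef := hS.submatrix Subtype.val_injective
    exact this.det_pos.ne'.isUnit
  have h1 := Matrix.mul_nonsing_inv _ hu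
  have h2 : (subm S Q Q * (subm S Q Q)⁻¹ * S.submatrix (fun j : Q => (j : V)) id) ⟨v, hv⟩ y
      = S v y := by
    rw [h1, Matrix.one_mul]; rfl
  rw [fullCov, Matrix.sub_apply, ← h2, sub_eq_zero]
  simp [Matrix.mul_apply, subm]

theorem fullCov_K (S : Matrix V V ℝ) (hS : S.PosDef) (Q : Finset V) (z y : V) (hz : z ∉ Q) :
    (S⁻¹ * fullCov S Q) z y = (1 : Matrix V V ℝ) z y := by
  have hu : IsUnit S.det := hS.det_pos.ne'.isUnit
  have h1 := Matrix.nonsing_inv_mul _ hu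
  have h2 : S⁻¹ * S.submatrix id (fun j : Q => (j : V)) =
      (1 : Matrix V V ℝ).submatrix id (fun j : Q => (j : V)) := by
    rw [← h1]; ext i j; simp [Matrix.mul_apply]
  rw [fullCov, Matrix.mul_sub, h1, Matrix.sub_apply, sub_eq_self, ← Matrix.mul_assoc,
    ← Matrix.mul_assoc, h2, Matrix.mul_assoc, Matrix.mul_apply]
  apply Finset.sum_eq_zero
  intro j _
  have : z ≠ (j : V) := fun h => hz (h ▸ j.2)
  simp [Matrix.one_apply, this]

/-- A vector supported off `Q` which is annihilated by `K` off `Q` vanishes. -/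
theorem vec_zero (K : Matrix V V ℝ) (hK : K.PosDef) (c : V → ℝ)
    (h : ∀ z, c z = 0 ∨ (K *ᵥ c) z = 0) : c = 0 := by
  by_contra hc
  have := hK.dotProduct_mulVec_pos hc
  have h0 : star c ⬝ᵥ K *ᵥ c = 0 := by
    apply Finset.sum_eq_zero
    intro z _
    rcases h z with h | h <;> simp [h]
  linarith

theorem fullCov_diag (S : Matrix V V ℝ) (hS : S.PosDef) (Q : Finset V) (x : V) (hx : x ∉ Q) :
    fullCov S Q x x ≠ 0 := by
  intro h0
  have hk : ∀ z, (S⁻¹ *ᵥ (fun v => fullCov S Q v x)) z = (S⁻¹ * fullCov S Q) z x := fun z => rfl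
  have hc := vec_zero S⁻¹ hS.inv (fun v => fullCov S Q v x) (by
    intro z
    by_cases hz : z ∈ Q
    · exact Or.inl (fullCov_row S hS Q z x hz)
    · by_cases hzx : z = x
      · subst hzx; exact Or.inl h0
      · right
        rw [hk, fullCov_K S hS Q z x hz, Matrix.one_apply_ne hzx])
  have := hk x
  rw [hc, fullCov_K S hS Q x x hx] at this
  simp at this

theorem fullCov_insert (S : Matrix V V ℝ) (hS : S.PosDef) (Q : Finset V) (x : V) (hx : x ∉ Q)
    (v y : V) : fullCov S (insert x Q) v y =
      fullCov S Q v y - fullCov S Q v x * (fullCov S Q x y / fullCov S Q x x) := by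
  have hd := fullCov_diag S hS Q x hx
  set r := fullCov S Q x y / fullCov S Q x x with hr
  have hc := vec_zero S⁻¹ hS.inv
    (fun v => fullCov S (insert x Q) v y - (fullCov S Q v y - fullCov S Q v x * r)) (by
    intro z
    by_cases hz : z ∈ insert x Q
    · left
      simp only [fullCov_row S hS _ z y hz]
      rcases Finset.mem_insert.1 hz with h | h
      · subst h; rw [hr]; field_simp; ring
      · simp [fullCov_row S hS _ z _ h]
    · right
      have hzQ : z ∉ Q := fun h => hz (Finset.mem_insert_of_mem h)
      have hzx : z ≠ x := fun h => hz (h ▸ Finset.mem_insert_self _ _)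
      have e : (S⁻¹ *ᵥ (fun v => fullCov S (insert x Q) v y -
          (fullCov S Q v y - fullCov S Q v x * r))) z =
          (S⁻¹ * fullCov S (insert x Q)) z y - ((S⁻¹ * fullCov S Q) z y
            - (S⁻¹ * fullCov S Q) z x * r) := by
        simp only [Matrix.mul_apply, Matrix.mulVec, dotProduct, Finset.sum_mul,
          ← Finset.sum_sub_distrib]
        apply Finset.sum_congr rfl
        intros; ring
      rw [e, fullCov_K S hS _ z y hz, fullCov_K S hS _ z y hzQ, fullCov_K S hS _ z x hzQ,
        Matrix.one_apply_ne hzx]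
      ring)
  have := congrFun hc v
  simp only [Pi.zero_apply] at this
  linarith

theorem det_step (M N : Matrix V V ℝ) (x : V) (hd : M x x ≠ 0)
    (hN : ∀ v y, N v y = M v y - M v x * (M x y / M x x)) (P : Finset V) (hx : x ∉ P) :
    pdet M (insert x P) = M x x * pdet N P := by
  unfold pdet
  let e : (Unit ⊕ P) ≃ (insert x P : Finset V) :=
    (Equiv.sumComm _ _).trans ((Equiv.optionEquivSumPUnit P).symm.trans
      (Finset.subtypeInsertEquivOption hx).symm)
  have e1 : ∀ u, (e (Sum.inl u) : V) = x := fun u => rfl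
  have e2 : ∀ u : P, (e (Sum.inr u) : V) = u := fun u => rfl
  rw [← Matrix.det_submatrix_equiv_self e]
  let A : Matrix Unit Unit ℝ := Matrix.of fun _ _ => M x x
  have hA : IsUnit A.det := by simpa [A] using hd
  haveI : Invertible A := A.invertibleOfIsUnitDet hA
  have : (subm M (insert x P) (insert x P)).submatrix e e =
      Matrix.fromBlocks A (Matrix.of fun (_ : Unit) (j : P) => M x j)
        (Matrix.of fun (i : P) (_ : Unit) => M i x) (subm M P P) := by
    ext i j
    rcases i with i | i <;> rcases j with j | j <;> simp [subm, A, e1, e2]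
  rw [this, Matrix.det_fromBlocks₁₁]
  congr 1
  · simp [A]
  · congr 1
    ext i j
    simp [Matrix.mul_apply, subm, hN]
    simp only [A, Matrix.of_apply]
    ring

theorem step_rec (S : Matrix V V ℝ) (hS : S.PosDef) (Q : Finset V) (x y : V) (hx : x ∉ Q)
    (hxy : x ≠ y) :
    fullCov S Q x y = ∑ z, - (fullCov S Q x x * S⁻¹ x z * fullCov S (insert x Q) z y) := by
  have hd := fullCov_diag S hS Q x hx
  have h1 := fullCov_K S hS Q x y hx
  have h2 := fullCov_K S hS Q x x hx
  rw [Matrix.one_apply_ne hxy] at h1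
  rw [Matrix.one_apply_eq] at h2
  have : ∑ z, - (fullCov S Q x x * S⁻¹ x z * fullCov S (insert x Q) z y) =
      - fullCov S Q x x * ((S⁻¹ * fullCov S Q) x y -
        (S⁻¹ * fullCov S Q) x x * (fullCov S Q x y / fullCov S Q x x)) := by
    simp only [Matrix.mul_apply, Finset.sum_mul, ← Finset.sum_sub_distrib, Finset.mul_sum]
    apply Finset.sum_congr rfl
    intro z _
    rw [fullCov_insert S hS Q x hx]; ring
  rw [this, h1, h2]
  field_simp
  ring

/-- The weight of a walk, given `Q`. -/
noncomputable def wWeight (S K : Matrix V V ℝ) (Q : Finset V) {G : SimpleGraph V} {x y : V}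
    (p : G.Walk x y) : ℝ :=
  (-1 : ℝ) ^ (p.support.toFinset.card + 1) * (pcov S p.support.toFinset Q).det
    * (p.darts.map (fun d => K d.toProd.1 d.toProd.2)).prod

theorem wWeight_cons (S K : Matrix V V ℝ) (hS : S.PosDef) (Q : Finset V) {G : SimpleGraph V}
    {x z y : V} (h : G.Adj x z) (p : G.Walk z y) (hx : x ∉ p.support) (hxQ : x ∉ Q) :
    wWeight S K Q (SimpleGraph.Walk.cons h p) =
      - (fullCov S Q x x * K x z * wWeight S K (insert x Q) p) := by
  have hx' : x ∉ p.support.toFinset := by simpa using hx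
  have hdet := det_step (fullCov S Q) (fullCov S (insert x Q)) x (fullCov_diag S hS Q x hxQ)
    (fullCov_insert S hS Q x hxQ) p.support.toFinset hx'
  simp only [wWeight, pcov_det]
  simp only [SimpleGraph.Walk.support_cons, List.toFinset_cons,
    SimpleGraph.Walk.darts_cons, List.map_cons, List.prod_cons]
  rw [hdet, Finset.card_insert_of_notMem hx', pow_succ _ (_ + 1)]
  ring

theorem main_rec (S K : Matrix V V ℝ) (hS : S.PosDef) (hK : K = S⁻¹)
    (G : SimpleGraph V) [DecidableRel G.Adj] (hGK : MatImplies K G) (y : V) (n : ℕ) :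
    ∀ (Q : Finset V) (x : V), Qᶜ.card = n → y ∉ Q → 
    fullCov S Q x y = ∑ p ∈ Finset.univ.filter
            (fun p : G.Path x y => (p : G.Walk x y).support.toFinset ⊆ Qᶜ),
            wWeight S K Q (p : G.Walk x y) := by
  induction n with
  | zero =>
    intro Q x hn hy
    rw [Finset.card_eq_zero, Finset.compl_eq_empty_iff] at hn
    simp [hn] at hy
  | succ n ih =>
    intro Q x hn hy
    by_cases hx : x ∈ Q
    · rw [fullCov_row S hS Q x y hx, Finset.filter_eq_empty_iff.2, Finset.sum_empty]
      intro p _ hp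
      have := hp (List.mem_toFinset.2 (p : G.Walk x y).start_mem_support)
      simp [hx] at this
    by_cases hxy : x = y
    · subst hxy
      have : Finset.univ.filter
            (fun p : G.Path x x => (p : G.Walk x x).support.toFinset ⊆ Qᶜ) =
            {SimpleGraph.Path.nil} := by
        ext p
        have hp : p = SimpleGraph.Path.nil := SimpleGraph.Path.loop_eq p
        subst hp
        simp [hx]
      rw [this, Finset.sum_singleton]
      simp only [wWeight, pcov_det]
      simp only [SimpleGraph.Path.nil]
      have e : ([x] : List V).toFinset = insert x ∅ := by simp
      have hdet := det_step (fullCov S Q) (fullCov S (insert x Q)) x (fullCov_diag S hS Q x hx)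
        (fullCov_insert S hS Q x hx) ∅ (by simp)
      simp only [SimpleGraph.Walk.support_nil]
      rw [e]
      rw [hdet]
      simp [pdet]
    · have hyQ : y ∉ insert x Q := by
        simp [hy, Ne.symm hxy]
      have hcard : (insert x Q)ᶜ.card = n := by
        have := Finset.card_insert_of_notMem hx
        have h1 := Finset.card_add_card_compl Q
        have h2 := Finset.card_add_card_compl (insert x Q)
        omega
      rw [step_rec S hS Q x y hx hxy]
      have hsub : ∑ z, - (fullCov S Q x x * S⁻¹ x z * fullCov S (insert x Q) z y) =
          ∑ z : {z // G.Adj x z},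
            - (fullCov S Q x x * K x z * fullCov S (insert x Q) z y) := by
        rw [← Finset.sum_subtype (Finset.univ.filter (fun z => G.Adj x z)) (by simp)
          (fun z => - (fullCov S Q x x * K x z * fullCov S (insert x Q) z y)), ← hK]
        symm
        apply Finset.sum_subset (Finset.subset_univ _)
        intro z _ hz
        have hz' : ¬ G.Adj x z := by simpa using hz
        by_cases hzx : x = z
        · subst hzx
          rw [fullCov_row S hS _ x y (Finset.mem_insert_self _ _)]
          simp
        · have : K x z = 0 := by
            by_contra h
            exact hz' (hGK x z hzx h)
          rw [this]
          simp
      rw [hsub]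
      simp_rw [ih (insert x Q) _ hcard hyQ, Finset.mul_sum, ← Finset.sum_neg_distrib]
      rw [Finset.sum_sigma']
      have hmem : ∀ a : (Σ z : {z // G.Adj x z}, G.Path z.1 y),
          a ∈ (Finset.univ.sigma fun z : {z // G.Adj x z} => Finset.univ.filter
            (fun p : G.Path z.1 y => (p : G.Walk z.1 y).support.toFinset ⊆ (insert x Q)ᶜ)) →
            x ∉ (a.2 : G.Walk a.1.1 y).support := by
        intro a ha hxa
        simp only [Finset.mem_sigma, Finset.mem_filter] at ha
        have := ha.2.2 (List.mem_toFinset.2 hxa)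
        simp at this
      refine Finset.sum_bij
        (fun a ha => ⟨SimpleGraph.Walk.cons a.1.2 a.2.1, a.2.2.cons (hmem a ha)⟩) ?_ ?_ ?_ ?_
      · intro a ha
        simp only [Finset.mem_sigma, Finset.mem_filter] at ha
        simp only [Finset.mem_filter, Finset.mem_univ, true_and, SimpleGraph.Walk.support_cons,
          List.toFinset_cons]
        refine Finset.insert_subset (by simpa using hx) (ha.2.2.trans ?_)
        exact Finset.compl_subset_compl.2 (Finset.subset_insert _ _)
      · rintro ⟨⟨z, hz⟩, ⟨p, hp⟩⟩ ha ⟨⟨z', hz'⟩, ⟨p', hp'⟩⟩ ha' h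
        simp only [Subtype.mk.injEq, SimpleGraph.Walk.cons.injEq] at h
        obtain ⟨h1, h2⟩ := h
        subst h1
        simp only [heq_eq_eq] at h2
        subst h2
        rfl
      · rintro ⟨p, hp⟩ hb
        cases p with
        | nil => exact absurd rfl hxy
        | @cons _ z _ h p =>
          rw [SimpleGraph.Walk.cons_isPath_iff] at hp
          refine ⟨⟨⟨z, h⟩, ⟨p, hp.1⟩⟩, ?_, rfl⟩
          simp only [Finset.mem_filter, Finset.mem_univ, true_and,
            SimpleGraph.Walk.support_cons, List.toFinset_cons] at hb
          simp only [Finset.mem_sigma, Finset.mem_filter, Finset.mem_univ, true_and]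
          intro v hv
          have h1 := hb (Finset.mem_insert_of_mem hv)
          have h2 : v ≠ x := by
            rintro rfl
            exact hp.2 (List.mem_toFinset.1 hv)
          simp_all
      · intro a ha
        rw [wWeight_cons S K hS Q a.1.2 a.2.1 (hmem a ha) hx]

/-- decomposition of the limited-order partial covariance over the
paths of the induced subgraph (intermediate identity in the proof of Theorem 3). -/
theorem limited_order_partial_cov_decomposition
    (S K : Matrix V V ℝ) (hS : S.PosDef) (hK : K = S⁻¹)
    (G : SimpleGraph V) [DecidableRel G.Adj] (hGK : MatImplies K G)
    (x y : V) (hxy : x ≠ y) (Q : Finset V) (hQ : Q ⊆ ({x, y} : Finset V)ᶜ) :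
    pcov S {x, y} Q ⟨x, by simp⟩ ⟨y, by simp⟩
      = ∑ p ∈ Finset.univ.filter
            (fun p : G.Path x y => (p : G.Walk x y).support.toFinset ⊆ Qᶜ),
          (-1 : ℝ) ^ ((p : G.Walk x y).support.toFinset.card + 1)
            * (pcov S (p : G.Walk x y).support.toFinset Q).det
            * ((p : G.Walk x y).darts.map (fun d => K d.toProd.1 d.toProd.2)).prod := by
  rw [pcov_eq_fullCov]
  have hy : y ∉ Q := fun h => by simpa using hQ h
  exact main_rec S K hS hK G hGK y _ Q x rfl hy
end

section
/- Let Σ be a positive definite real matrix indexed by a finite set V with K = Σ⁻¹, and suppose K implies the graph G = (V, E). If {x, y} ∉ E for distinct x, y ∈ V, then the partial covariance σ_{xy·V\{x,y}} = 0 and hence the networked partial covariance ω_{xy·V\{x,y}} = σ_{xy·V\{x,y}} / (1 − ρ²_{{x,y}:V\{x,y}}) = 0. -/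
open Matrix BigOperators

variable {V : Type*} [Fintype V] [DecidableEq V]

theorem subm_mul_split (M N : Matrix V V ℝ) (A B C : Finset V) :
    subm (M * N) A C = subm M A B * subm N B C + subm M A Bᶜ * subm N Bᶜ C := by
  ext i j
  simp only [subm, Matrix.submatrix_apply, Matrix.add_apply, Matrix.mul_apply]
  rw [Finset.sum_coe_sort B (fun k => M i k * N k j),
    Finset.sum_coe_sort Bᶜ (fun k => M i k * N k j), Finset.sum_add_sum_compl]

/-- for a missing edge, the partial covariance and hence the
networked partial covariance vanish. -/
theorem missing_edge_zero_npcov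
    (S K : Matrix V V ℝ) (hS : S.PosDef) (hK : K = S⁻¹)
    (G : SimpleGraph V) (hGK : MatImplies K G)
    (x y : V) (hxy : x ≠ y) (h : ¬ G.Adj x y) :
    pcov S {x, y} ({x, y} : Finset V)ᶜ ⟨x, by simp⟩ ⟨y, by simp⟩ = 0 ∧
    pcov S {x, y} ({x, y} : Finset V)ᶜ ⟨x, by simp⟩ ⟨y, by simp⟩
      / (1 - rho2 S {x, y} ({x, y} : Finset V)ᶜ) = 0 := by
  have hmain : pcov S {x, y} ({x, y} : Finset V)ᶜ ⟨x, by simp⟩ ⟨y, by simp⟩ = 0 := by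
    have hz : S⁻¹ x y = 0 := by
      by_contra hne
      exact h (hGK x y hxy (by rw [hK]; exact hne))
    have hpos : 0 < S⁻¹ y y := hS.inv.diag_pos
    have hP := congrFun (congrFun (pcov_mul_inv S hS {x, y}) ⟨x, by simp⟩) ⟨y, by simp⟩
    rw [Matrix.mul_apply, Matrix.one_apply_ne (by simpa using hxy),
      Finset.sum_eq_single (⟨y, by simp⟩ : ({x, y} : Finset V))] at hP
    · exact (mul_eq_zero.1 hP).resolve_right hpos.ne'
    · rintro ⟨b, hb⟩ - hne
      have hbx : b = x := by
        rcases Finset.mem_insert.1 hb with e | e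
        · exact e
        · exact absurd (Subtype.ext (Finset.mem_singleton.1 e)) hne
      subst hbx
      simp [subm, hz]
    · simp
  exact ⟨hmain, by rw [hmain, zero_div]⟩
end

section
/- Let Σ be a positive definite real matrix indexed by a finite set V with K = Σ⁻¹, and suppose K implies the graph G = (V, E). Let x, y ∈ V be distinct and suppose the pair {x, y} is disconnected from the rest of the network, i.e., there is no edge in E joining a vertex of {x, y} to a vertex of V \ {x, y}. Then the squared vector correlation ρ²_{{x,y}:V\{x,y}} = 0, and consequently the networked partial covariance satisfies ω_{xy·V\{x,y}} = σ_{xy·V\{x,y}}. -/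
open Matrix BigOperators

variable {V : Type*} [Fintype V] [DecidableEq V]

/-- if the pair {x, y} is disconnected from the rest of the network,
then the squared vector correlation vanishes and the networked partial covariance
equals the partial covariance. -/
theorem disconnected_pair_npcov_eq_pcov
    (S K : Matrix V V ℝ) (hS : S.PosDef) (hK : K = S⁻¹)
    (G : SimpleGraph V) (hGK : MatImplies K G)
    (x y : V) (hxy : x ≠ y)
    (hdis : ∀ u ∈ ({x, y} : Finset V), ∀ v ∉ ({x, y} : Finset V), ¬ G.Adj u v) :
    rho2 S {x, y} ({x, y} : Finset V)ᶜ = 0 ∧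
    pcov S {x, y} ({x, y} : Finset V)ᶜ ⟨x, by simp⟩ ⟨y, by simp⟩
        / (1 - rho2 S {x, y} ({x, y} : Finset V)ᶜ)
      = pcov S {x, y} ({x, y} : Finset V)ᶜ ⟨x, by simp⟩ ⟨y, by simp⟩ := by
  have hu : IsUnit S := hS.isUnit
  have hdetS : S.det ≠ 0 := hS.det_pos.ne'
  have hKS : K * S = 1 := by
    rw [hK]; exact Matrix.nonsing_inv_mul S ((Matrix.isUnit_iff_isUnit_det S).1 hu)
  have hSK : S * K = 1 := by
    rw [hK]; exact Matrix.mul_nonsing_inv S ((Matrix.isUnit_iff_isUnit_det S).1 hu)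
  have hdis' : ∀ u v, ¬ (u ∈ ({x, y} : Finset V) ↔ v ∈ ({x, y} : Finset V)) → K u v = 0 := by
    intro u v h
    by_contra hne
    have huv : u ≠ v := by rintro rfl; exact h Iff.rfl
    have hadj := hGK u v huv hne
    by_cases h1 : u ∈ ({x, y} : Finset V)
    · exact hdis u h1 v (fun h2 => h ⟨fun _ => h2, fun _ => h1⟩) hadj
    · by_cases h2 : v ∈ ({x, y} : Finset V)
      · exact hdis v h2 u h1 hadj.symm
      · exact h ⟨fun h3 => absurd h3 h1, fun h3 => absurd h3 h2⟩
  have key : ∀ A : Finset V, A = {x, y} → alien S A Aᶜ = 1 := by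
    intro A hA
    rw [← hA] at hdis'
    let P : Matrix V V ℝ := Matrix.diagonal (fun u => if u ∈ A then 1 else 0)
    have hcomm : P * K = K * P := by
      ext u v
      simp only [P, Matrix.diagonal_mul, Matrix.mul_diagonal]
      by_cases h : (u ∈ A ↔ v ∈ A)
      · by_cases h1 : v ∈ A <;> simp [h, h1]
      · simp [hdis' u v h]
    have hcommS : S * P = P * S := by
      calc S * P = S * (P * (K * S)) := by rw [hKS, mul_one]
        _ = S * (P * K) * S := by simp only [mul_assoc]
        _ = (S * K) * (P * S) := by rw [hcomm]; simp only [mul_assoc]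
        _ = P * S := by rw [hSK, one_mul]
    have hz : ∀ i, ¬ i ∈ A → ∀ j, j ∈ A → S i j = 0 := by
      intro i hi j hj
      have := congrFun (congrFun hcommS i) j
      simpa [P, Matrix.diagonal_mul, Matrix.mul_diagonal, hi, hj] using this
    have hdet := Matrix.twoBlockTriangular_det S (fun i => i ∈ A) hz
    have e1 : (subm S A A).det = (Matrix.toSquareBlockProp S (fun i => i ∈ A)).det := by
      rw [← Matrix.det_submatrix_equiv_self (Equiv.subtypeEquivRight (p := (· ∈ A)) (q := (· ∈ A)) (fun _ => Iff.rfl))]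
      congr!
    have e2 : (subm S Aᶜ Aᶜ).det = (Matrix.toSquareBlockProp S (fun i => ¬ i ∈ A)).det := by
      rw [← Matrix.det_submatrix_equiv_self
        (Equiv.subtypeEquivRight (p := (· ∈ Aᶜ)) (q := fun i => ¬ i ∈ A) (fun _ => Finset.mem_compl))]
      congr!
    have e3 : (subm S (A ∪ Aᶜ) (A ∪ Aᶜ)).det = S.det := by
      rw [← Matrix.det_submatrix_equiv_self
        (Equiv.subtypeUnivEquiv (p := (· ∈ A ∪ Aᶜ)) (fun u => by simp)) S]
      congr!
    have e4 : S.det = (subm S A A).det * (subm S Aᶜ Aᶜ).det := by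
      rw [e1, e2, hdet]
      congr!
    unfold alien
    rw [e3, ← e4, div_self hdetS]
  have h0 : rho2 S {x, y} ({x, y} : Finset V)ᶜ = 0 := by
    unfold rho2
    rw [key _ rfl, sub_self]
  refine ⟨h0, ?_⟩
  rw [h0, sub_zero, div_one]
end
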